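/- arXiv:2407.10522 — 2 statements merged into one kernel-verified Lean document; each statement's English description precedes it below -/
import Mathlib

section
/- Let k be a perfect field of characteristic p > 0 and let A = k ⊗_{F_p} k be the tensor product of k with itself over the prime field, viewed as a commutative k-algebra. Regard k as an A-module via the multiplication map A → k, λ ⊗ μ ↦ λμ. Then Ext^n_A(k, k) = 0 for every n ≥ 1. -/
/-! STATEMENT 6: for a perfect field `k` of characteristic `p > 0`, and `A = k ⊗_{F_p} k`,
the `A`-module `k` (via the multiplication map `A → k`) satisfies `Ext^n_A(k, k) = 0` for all
`n ≥ 1` (vanishing of the Hochschild cohomology of `k` in positive degrees). -/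

universe w u

open CategoryTheory Abelian
open scoped TensorProduct

namespace DjamentTouze

section

variable (p : ℕ) [Fact p.Prime] (k : Type u) [Field k] [Algebra (ZMod p) k]

/-- The enveloping algebra `A = k ⊗_{F_p} k` of `k` over its prime field. -/
abbrev EnvAlg : Type u := k ⊗[ZMod p] k

/-- `k`, regarded as a module over `A = k ⊗_{F_p} k` through the multiplication map
`A → k`, `λ ⊗ μ ↦ λμ`. -/
noncomputable local instance : Module (EnvAlg p k) k :=
  Module.compHom k (Algebra.TensorProduct.lmul' (ZMod p) (S := k)).toRingHom

section
universe v

variable (F : Type u) [CommRing F] (K : Type v) [CommRing K] [Algebra F K]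

/-- The tensor power `K^{⊗ X}` over `F`, i.e. the copower of `K` by `X` in commutative
`F`-algebras. -/
def AlgPower (X : Type) : Type (max u v) := ⨂[F] _ : X, K

namespace AlgPower

noncomputable instance (X : Type) : CommRing (AlgPower F K X) :=
  inferInstanceAs (CommRing (⨂[F] _ : X, K))

noncomputable instance (X : Type) : Algebra F (AlgPower F K X) :=
  inferInstanceAs (Algebra F (⨂[F] _ : X, K))

variable {X Y Z : Type}

open Classical in
/-- The inclusion of the factor indexed by `x`. -/
noncomputable def single (x : X) : K →ₐ[F] AlgPower F K X :=
  PiTensorProduct.singleAlgHom (R := F) (A := fun _ : X ↦ K) x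

variable {F K}

theorem hom_ext [Finite X] {S : Type*} [CommRing S] [Algebra F S]
    {f g : AlgPower F K X →ₐ[F] S}
    (h : ∀ x, f.comp (single F K x) = g.comp (single F K x)) : f = g := by
  classical
  refine PiTensorProduct.algHom_ext (A := fun _ : X ↦ K) fun x ↦ ?_
  have hx : single F K x = PiTensorProduct.singleAlgHom (R := F) (A := fun _ : X ↦ K) x := by
    unfold single; congr!
  exact hx ▸ h x

/-- The universal property of the copower. -/
noncomputable def lift [Fintype X] {S : Type*} [CommRing S] [Algebra F S]
    (g : X → K →ₐ[F] S) : AlgPower F K X →ₐ[F] S :=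
  PiTensorProduct.liftAlgHom (A := fun _ : X ↦ K)
    ((MultilinearMap.mkPiAlgebra F X S).compLinearMap fun x ↦ (g x).toLinearMap)
    (by simp) (by simp [Finset.prod_mul_distrib])

@[simp]
theorem lift_comp_single [Fintype X] {S : Type*} [CommRing S] [Algebra F S]
    (g : X → K →ₐ[F] S) (x : X) : (lift g).comp (single F K x) = g x := by
  classical
  ext a
  have : ∀ y, g y (Pi.mulSingle (M := fun _ : X ↦ K) x a y) =
      Pi.mulSingle (M := fun _ : X ↦ S) x (g x a) y := fun y ↦ by
    rcases eq_or_ne y x with rfl | h <;> simp [*]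
  trans ∏ y, g y (Pi.mulSingle (M := fun _ : X ↦ K) x a y)
  · simp only [lift, single, PiTensorProduct.liftAlgHom, PiTensorProduct.singleAlgHom]
    erw [PiTensorProduct.lift.tprod]
    simp only [MultilinearMap.compLinearMap_apply, MultilinearMap.mkPiAlgebra_apply]
    refine Finset.prod_congr rfl fun y _ ↦ ?_
    simp only [MonoidHom.mulSingle_apply, AlgHom.toLinearMap_apply]
  · simp [this]

@[simp]
theorem lift_single [Fintype X] {S : Type*} [CommRing S] [Algebra F S]
    (g : X → K →ₐ[F] S) (x : X) (a : K) : lift g (single F K x a) = g x a :=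
  DFunLike.congr_fun (lift_comp_single g x) a

variable (F K) in
/-- Functoriality of the copower in the index set. -/
noncomputable def map [Fintype X] (f : X → Y) : AlgPower F K X →ₐ[F] AlgPower F K Y :=
  lift fun x ↦ single F K (f x)

@[simp]
theorem map_single [Fintype X] (f : X → Y) (x : X) (a : K) :
    map F K f (single F K x a) = single F K (f x) a :=
  lift_single _ _ _

theorem map_map [Fintype X] [Fintype Y] (g : Y → Z) (f : X → Y) (q : AlgPower F K X) :
    map F K g (map F K f q) = map F K (g ∘ f) q :=
  DFunLike.congr_fun (f := (map F K g).comp (map F K f)) (hom_ext fun x ↦ by ext; simp) q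

theorem map_id [Fintype X] (q : AlgPower F K X) : map F K id q = q :=
  DFunLike.congr_fun (g := AlgHom.id F _) (hom_ext fun x ↦ by ext; simp) q

/-- `K^{⊗ X}` as an algebra over `K ⊗ K` through the factors indexed by `x` and `y`. -/
noncomputable abbrev algebraOfPair (x y : X) : Algebra (K ⊗[F] K) (AlgPower F K X) :=
  (Algebra.TensorProduct.productMap (single F K x) (single F K y)).toRingHom.toAlgebra

theorem free_of_ne {F : Type u} [Field F] [Algebra F K] [Fintype X] {x y : X} (h : x ≠ y) :
    let := algebraOfPair (F := F) (K := K) x y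
    Module.Free (K ⊗[F] K) (AlgPower F K X) := by
  classical
  let := algebraOfPair (F := F) (K := K) x y
  let X' := {z : X // z ≠ x ∧ z ≠ y}
  let f : (K ⊗[F] K) ⊗[F] AlgPower F K X' →ₐ[F] AlgPower F K X :=
    Algebra.TensorProduct.productMap
      (Algebra.TensorProduct.productMap (single F K x) (single F K y)) (map F K Subtype.val)
  let g : AlgPower F K X →ₐ[F] (K ⊗[F] K) ⊗[F] AlgPower F K X' := lift fun z ↦
    if hx : z = x then
      Algebra.TensorProduct.includeLeft.comp Algebra.TensorProduct.includeLeft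
    else if hy : z = y then
      Algebra.TensorProduct.includeLeft.comp Algebra.TensorProduct.includeRight
    else Algebra.TensorProduct.includeRight.comp (single F K ⟨z, hx, hy⟩)
  have hfg : f.comp g = AlgHom.id F _ := by
    refine hom_ext fun z ↦ ?_
    ext a
    by_cases hx : z = x
    · subst hx; simp [f, g, Algebra.TensorProduct.includeLeft_apply]
    by_cases hy : z = y
    · subst hy; simp [f, g, hx]
    simp [f, g, hx, hy]
  have hgf : g.comp f = AlgHom.id F _ := by
    apply Algebra.TensorProduct.ext
    · apply Algebra.TensorProduct.ext
      · ext a; simp [f, g]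
      · ext a; simp [f, g, h.symm]
    · refine hom_ext fun z ↦ ?_
      ext a
      simp [f, g, z.2.1, z.2.2]
  let e : (K ⊗[F] K) ⊗[F] AlgPower F K X' ≃ₗ[K ⊗[F] K] AlgPower F K X :=
    { AlgEquiv.ofAlgHom f g hfg hgf with
      map_smul' := fun a q ↦ by
        change f (a • q) = algebraMap (K ⊗[F] K) _ a * f q
        induction q with
        | zero => simp
        | add q r hq hr => rw [smul_add, map_add, map_add, hq, hr, mul_add]
        | tmul b t =>
          rw [TensorProduct.smul_tmul', Algebra.TensorProduct.productMap_apply_tmul,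
            Algebra.TensorProduct.productMap_apply_tmul, smul_eq_mul, map_mul, mul_assoc]
          rfl }
  exact Module.Free.of_equiv e

end AlgPower

namespace AlgPower

variable {p} {K : Type v} [CommRing K] [Algebra (ZMod p) K]

instance (X : Type) [Fintype X] [Nontrivial K] : Nontrivial (AlgPower (ZMod p) K X) :=
  (lift fun _ : X ↦ AlgHom.id (ZMod p) K).toRingHom.domain_nontrivial

instance (X : Type) [Fintype X] [Nontrivial K] : CharP (AlgPower (ZMod p) K X) p :=
  charP_of_injective_algebraMap (algebraMap (ZMod p) _).injective p

instance [Nontrivial K] [PerfectRing K p] (X : Type) [Fintype X] :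
    PerfectRing (AlgPower (ZMod p) K X) p := by
  have : CharP K p := charP_of_injective_algebraMap (algebraMap (ZMod p) K).injective p
  let Φ : AlgPower (ZMod p) K X →ₐ[ZMod p] AlgPower (ZMod p) K X :=
    { toRingHom := frobenius _ p
      commutes' := RingHom.congr_fun
        (RingHom.ext_zmod ((frobenius _ p).comp (algebraMap (ZMod p) _)) _) }
  let Ψ : K →ₐ[ZMod p] K :=
    { toRingHom := (frobeniusEquiv K p).symm.toRingHom
      commutes' := RingHom.congr_fun (RingHom.ext_zmod
        ((frobeniusEquiv K p).symm.toRingHom.comp (algebraMap (ZMod p) _)) _) }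
  have hΨ (a : K) : Ψ a ^ p = a := frobeniusEquiv_symm_pow_p K p a
  have hΨ' (a : K) : Ψ (a ^ p) = a := frobeniusEquiv_symm_pow K p a
  let Ψ' := lift fun x : X ↦ (single (ZMod p) K x).comp Ψ
  have h₁ : Φ.comp Ψ' = AlgHom.id _ _ := hom_ext fun x ↦ by
    ext a
    change Ψ' (single _ K x a) ^ p = single _ K x a
    rw [AlgPower.lift_single, AlgHom.comp_apply, ← map_pow, hΨ]
  have h₂ : Ψ'.comp Φ = AlgHom.id _ _ := hom_ext fun x ↦ by
    ext a
    change Ψ' (single _ K x a ^ p) = single _ K x a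
    rw [← map_pow, AlgPower.lift_single, AlgHom.comp_apply, hΨ']
  exact ⟨Function.bijective_iff_has_inverse.2
    ⟨Ψ', DFunLike.congr_fun h₂, DFunLike.congr_fun h₁⟩⟩

end AlgPower
end

section
/-- A functional on `M` that vanishes on `d ⁻¹ (I N)`, `I = ker (A → K)`, extends along `d`. -/
theorem exists_comp_eq_of_ker_smul_top {A K M N : Type*} [CommRing A] [Field K] [Algebra K A]
    [AddCommGroup M] [AddCommGroup N] [Module A M] [Module A N] [Module A K]
    (π : A →ₐ[K] K) (hπ : ∀ (a : A) (c : K), a • c = π a * c)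
    (d : M →ₗ[A] N) (f : M →ₗ[A] K)
    (h : ∀ x, d x ∈ (RingHom.ker π • ⊤ : Submodule A N) → f x = 0) :
    ∃ g : N →ₗ[A] K, g ∘ₗ d = f := by
  let Q := N ⧸ (RingHom.ker π • ⊤ : Submodule A N)
  let : Module K M := Module.compHom M (algebraMap K A)
  let : Module K Q := Module.compHom Q (algebraMap K A)
  let q : N →ₗ[A] Q := Submodule.mkQ _
  let d' : M →ₗ[K] Q :=
    { toFun := fun x ↦ q (d x)
      map_add' := by simp
      map_smul' := fun c x ↦ (q ∘ₗ d).map_smul (algebraMap K A c) x }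
  let f' : Module.Dual K M :=
    { toFun := f
      map_add' := by simp
      map_smul' := fun c x ↦ by
        change f (algebraMap K A c • x) = _
        simp [hπ] }
  have hf : f' ∈ LinearMap.range d'.dualMap := by
    rw [LinearMap.range_dualMap_eq_dualAnnihilator_ker, Submodule.mem_dualAnnihilator]
    exact fun x hx ↦ h x ((Submodule.Quotient.mk_eq_zero _).1 hx)
  obtain ⟨g, hg⟩ := hf
  refine ⟨{ toFun := fun x ↦ g (q x), map_add' := by simp, map_smul' := fun a x ↦ ?_ }, ?_⟩
  · have : q (a • x) = π a • q x := by
      change q (a • x) = algebraMap K A (π a) • q x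
      rw [← map_smul, ← sub_eq_zero, ← map_sub, ← sub_smul]
      refine (Submodule.Quotient.mk_eq_zero _).2 (Submodule.smul_mem_smul ?_ trivial)
      simp [RingHom.mem_ker]
    simp [this, hπ]
  · ext x
    exact DFunLike.congr_fun hg x
end

section
universe v

variable (F : Type u) [Field F] (K : Type v) [CommRing K] [Algebra F K]

/-- The `n`-th term of the simplicial resolution of `K` over `K ⊗ K`: the copower of `K` by the
set of `n`-simplices of the nerve of the contractible groupoid on two objects. -/
abbrev BarTerm (n : ℕ) : Type (max u v) := AlgPower F K (Fin (n + 1) → Fin 2)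

namespace BarTerm

noncomputable instance (n : ℕ) : Algebra (K ⊗[F] K) (BarTerm F K n) :=
  AlgPower.algebraOfPair (fun _ ↦ 0) fun _ ↦ 1

theorem algebraMap_tmul (n : ℕ) (a b : K) : algebraMap (K ⊗[F] K) (BarTerm F K n) (a ⊗ₜ b) =
    AlgPower.single F K (fun _ ↦ 0) a * AlgPower.single F K (fun _ ↦ 1) b := rfl

instance (n : ℕ) : Module.Free (K ⊗[F] K) (BarTerm F K n) :=
  AlgPower.free_of_ne fun h ↦ zero_ne_one (congr_fun h 0)

/-- The simplicial structure. -/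
noncomputable def map {m n : ℕ} (θ : Fin (m + 1) → Fin (n + 1)) :
    BarTerm F K n →ₐ[K ⊗[F] K] BarTerm F K m :=
  { AlgPower.map F K (· ∘ θ) with
    commutes' := fun a ↦ by
      change AlgPower.map F K (· ∘ θ) _ = _
      induction a with
      | zero => simp
      | add a b ha hb => simp [ha, hb]
      | tmul a b => simp [algebraMap_tmul]; rfl }

theorem map_apply {m n : ℕ} (θ : Fin (m + 1) → Fin (n + 1)) (x : BarTerm F K n) :
    map F K θ x = AlgPower.map F K (· ∘ θ) x := rfl

theorem map_map {l m n : ℕ} (θ : Fin (l + 1) → Fin (m + 1)) (η : Fin (m + 1) → Fin (n + 1))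
    (x : BarTerm F K n) : map F K θ (map F K η x) = map F K (η ∘ θ) x :=
  AlgPower.map_map _ _ x

end BarTerm

/-- The simplicial resolution of `K` over `K ⊗ K` by the free modules `BarTerm F K n`. -/
noncomputable def bar : SimplicialObject (ModuleCat.{max u v} (K ⊗[F] K)) where
  obj Δ := ModuleCat.of _ (BarTerm F K Δ.unop.len)
  map f := ModuleCat.ofHom (BarTerm.map F K f.unop.toOrderHom).toLinearMap
  map_id _ := ModuleCat.hom_ext <| LinearMap.ext fun x ↦ AlgPower.map_id x
  map_comp f g := ModuleCat.hom_ext <| LinearMap.ext fun x ↦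
    (BarTerm.map_map F K g.unop.toOrderHom f.unop.toOrderHom x).symm

namespace BarTerm

/-- The faces. -/
noncomputable def face {n : ℕ} (i : Fin (n + 2)) :
    BarTerm F K (n + 1) →ₐ[K ⊗[F] K] BarTerm F K n := map F K i.succAbove

/-- The degeneracies. -/
noncomputable def degen {n : ℕ} (i : Fin (n + 1)) :
    BarTerm F K n →ₐ[K ⊗[F] K] BarTerm F K (n + 1) := map F K i.predAbove

/-- The alternating sum of the faces. -/
noncomputable def d (n : ℕ) : BarTerm F K (n + 1) →ₗ[K ⊗[F] K] BarTerm F K n :=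
  ∑ i : Fin (n + 2), (-1 : ℤ) ^ (i : ℕ) • (face F K i).toLinearMap

theorem bar_objD (n : ℕ) :
    AlgebraicTopology.AlternatingFaceMapComplex.objD (bar F K) n = ModuleCat.ofHom (d F K n) := by
  refine Eq.trans ?_ (map_sum (ModuleCat.homAddEquiv (M := ModuleCat.of _ (BarTerm F K (n + 1)))
    (N := ModuleCat.of _ (BarTerm F K n))).symm _ _).symm
  refine Finset.sum_congr rfl fun i _ ↦ ?_
  rw [map_zsmul]
  rfl

variable {F K}

theorem d_apply {n : ℕ} (x : BarTerm F K (n + 1)) :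
    d F K n x = ∑ i : Fin (n + 2), (-1 : ℤ) ^ (i : ℕ) • face F K i x := by
  simp [d]

theorem face_degen_self {n : ℕ} (i : Fin (n + 1)) (x : BarTerm F K n) :
    face F K i.castSucc (degen F K i x) = x :=
  ConcreteCategory.congr_hom ((bar F K).δ_comp_σ_self (i := i)) x

theorem face_degen_succ {n : ℕ} (i : Fin (n + 1)) (x : BarTerm F K n) :
    face F K i.succ (degen F K i x) = x :=
  ConcreteCategory.congr_hom ((bar F K).δ_comp_σ_succ (i := i)) x

theorem face_degen_of_le {n : ℕ} {i : Fin (n + 2)} {j : Fin (n + 1)} (h : i ≤ j.castSucc)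
    (x : BarTerm F K (n + 1)) :
    face F K i.castSucc (degen F K j.succ x) = degen F K j (face F K i x) :=
  ConcreteCategory.congr_hom ((bar F K).δ_comp_σ_of_le h) x

theorem face_degen_of_gt {n : ℕ} {i : Fin (n + 2)} {j : Fin (n + 1)} (h : j.castSucc < i)
    (x : BarTerm F K (n + 1)) :
    face F K i.succ (degen F K j.castSucc x) = degen F K j (face F K i x) :=
  ConcreteCategory.congr_hom ((bar F K).δ_comp_σ_of_gt h) x

/-- The extra degeneracy. -/
noncomputable def extra (n : ℕ) : BarTerm F K n →ₐ[F] BarTerm F K (n + 1) :=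
  AlgPower.map F K fun u ↦ Fin.cons 0 u

theorem face_zero_extra {n : ℕ} (x : BarTerm F K n) : face F K 0 (extra n x) = x := by
  rw [face, map_apply, extra, AlgPower.map_map]
  exact AlgPower.map_id x

theorem face_succ_extra {n : ℕ} (i : Fin (n + 2)) (x : BarTerm F K (n + 1)) :
    face F K i.succ (extra (n + 1) x) = extra n (face F K i x) := by
  rw [face, face, map_apply, map_apply, extra, extra, AlgPower.map_map, AlgPower.map_map]
  congr 2
  ext u j : 2
  refine Fin.cases ?_ (fun j ↦ ?_) j <;> simp

/-- The augmentation. -/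
noncomputable def aug : BarTerm F K 0 →ₐ[F] K := AlgPower.lift fun _ ↦ AlgHom.id F K

theorem face_one_extra (x : BarTerm F K 0) :
    face F K 1 (extra 0 x) = AlgPower.single F K (fun _ ↦ 0) (aug x) := by
  refine DFunLike.congr_fun
    (f := ((face F K 1).restrictScalars F).comp (extra (F := F) (K := K) 0))
    (g := (AlgPower.single F K fun _ ↦ 0).comp aug) (AlgPower.hom_ext fun u ↦ ?_) x
  ext a
  simp [face, map_apply, extra, aug]
  congr 1
  congr 1
  funext j
  rw [Subsingleton.elim j 0]
  rfl

theorem aug_algebraMap (a : K ⊗[F] K) :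
    aug (algebraMap _ (BarTerm F K 0) a) = Algebra.TensorProduct.lmul' F a := by
  induction a with
  | zero => simp
  | add a b ha hb => simp [ha, hb]
  | tmul a b => simp [algebraMap_tmul, aug]

theorem aug_face (i : Fin 2) (x : BarTerm F K 1) :
    aug (face F K i x) = AlgPower.lift (fun _ ↦ AlgHom.id F K) x := by
  refine DFunLike.congr_fun
    (f := (aug (F := F) (K := K)).comp ((face F K i).restrictScalars F))
    (AlgPower.hom_ext fun u ↦ ?_) x
  ext a
  simp [face, map_apply, aug]

theorem aug_d (x : BarTerm F K 1) : aug (d F K 0 x) = 0 := by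
  simp [d_apply, Fin.sum_univ_succ, aug_face]

theorem exact_zero {x : BarTerm F K 0} (hx : aug x = 0) : ∃ y, d F K 0 y = x :=
  ⟨extra 0 x, by simp [d_apply, Fin.sum_univ_succ, face_zero_extra, face_one_extra, hx]⟩

theorem exact_succ {n : ℕ} {x : BarTerm F K (n + 1)} (hx : d F K n x = 0) :
    ∃ y, d F K (n + 1) y = x := by
  refine ⟨extra (n + 1) x, ?_⟩
  have h : extra n (d F K n x) = 0 := by rw [hx, map_zero]
  rw [d_apply, map_sum] at h
  rw [d_apply, Fin.sum_univ_succ]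
  simp only [face_zero_extra, face_succ_extra, Fin.val_succ, pow_succ]
  simpa using h

end BarTerm
end

section
open AlgebraicTopology AlternatingFaceMapComplex
open scoped Simplicial

/-- Elements whose alternating sum of faces lies in `I X` are congruent, modulo `I X` and
boundaries, to elements whose positive faces vanish. -/
theorem exists_higherFaces_eq_zero {A : Type*} [CommRing A]
    (X : SimplicialObject (ModuleCat A)) (I : Ideal A) {n : ℕ} (x : X _⦋n + 1⦌)
    (hx : objD X n x ∈ (I • ⊤ : Submodule A (X _⦋n⦌))) :
    ∃ (z : X _⦋n + 1⦌) (w : X _⦋n + 2⦌),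
      x - z - objD X (n + 1) w ∈ (I • ⊤ : Submodule A (X _⦋n + 1⦌)) ∧
      (∀ i : Fin (n + 1), X.δ i.succ z = 0) ∧
      X.δ 0 z ∈ (I • ⊤ : Submodule A (X _⦋n⦌)) := by
  have map_mem {M N : ModuleCat A} (f : M ⟶ N) {y : M} (hy : y ∈ (I • ⊤ : Submodule A M)) :
      f y ∈ (I • ⊤ : Submodule A N) := by
    have : (I • ⊤ : Submodule A M).map f.hom ≤ I • ⊤ := by
      rw [Submodule.map_smul'']
      exact smul_mono_right _ le_top
    exact this ⟨y, hy, rfl⟩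
  let P (m : ℕ) : X _⦋m⦌ ⟶ X _⦋m⦌ := (DoldKan.PInfty (X := X)).f m
  let h (m : ℕ) : X _⦋m⦌ ⟶ X _⦋m + 1⦌ := (DoldKan.homotopyPInftyToId X).hom m (m + 1)
  have comm : P (n + 1) ≫ objD X n = objD X n ≫ P n := by
    simpa using (DoldKan.PInfty (X := X)).comm (n + 1) n
  have homotopy : P (n + 1) = objD X n ≫ h n + h (n + 1) ≫ objD X (n + 1) + 𝟙 _ := by
    have := (DoldKan.homotopyPInftyToId X).comm (n + 1)
    rw [Homotopy.dNext_succ_chainComplex, Homotopy.prevD_chainComplex,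
      obj_d_eq, obj_d_eq] at this
    exact this
  have hz (i : Fin (n + 1)) : X.δ i.succ (P (n + 1) x) = 0 :=
    ConcreteCategory.congr_hom (DoldKan.HigherFacesVanish.of_P (X := X) (n + 1) n i (by lia)) x
  have hd0 : objD X n (P (n + 1) x) = X.δ 0 (P (n + 1) x) := by
    change (objD X n).hom _ = _
    rw [objD, ModuleCat.hom_sum, LinearMap.sum_apply, Fin.sum_univ_succ, Finset.sum_eq_zero]
    · simp
    · intro i _
      change ((-1 : ℤ) ^ _) • X.δ i.succ (P (n + 1) x) = 0
      rw [hz, smul_zero]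
  have hP : P (n + 1) x = h n (objD X n x) + objD X (n + 1) (h (n + 1) x) + x :=
    ConcreteCategory.congr_hom homotopy x
  refine ⟨P (n + 1) x, -h (n + 1) x, ?_, hz, ?_⟩
  · have : x - P (n + 1) x - objD X (n + 1) (-h (n + 1) x) = -h n (objD X n x) := by
      rw [map_neg, hP]; abel
    exact this ▸ neg_mem (map_mem _ hx)
  · rw [← hd0, show objD X n (P (n + 1) x) = P n (objD X n x) from
      ConcreteCategory.congr_hom comm x]
    exact map_mem _ hx
end

section
universe v
open KaehlerDifferential
namespace BarTerm

section
variable (F : Type*) [Field F] (K : Type*) [CommRing K] [Algebra F K]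

/-- The ideal of `BarTerm F K n` generated by the kernel of `K ⊗ K → K`. -/
noncomputable def augIdeal (n : ℕ) : Ideal (BarTerm F K n) :=
  (ideal F K).map (algebraMap (K ⊗[F] K) (BarTerm F K n))

variable {F K}

theorem mem_augIdeal {n : ℕ} {x : BarTerm F K n} :
    x ∈ augIdeal F K n ↔ x ∈ (ideal F K • ⊤ : Submodule (K ⊗[F] K) (BarTerm F K n)) := by
  rw [Ideal.smul_top_eq_map]
  rfl

theorem map_mem_augIdeal {m n : ℕ} (f : BarTerm F K m →ₐ[K ⊗[F] K] BarTerm F K n)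
    {x : BarTerm F K m} (hx : x ∈ augIdeal F K m) : f x ∈ augIdeal F K n := by
  have : augIdeal F K m ≤ (augIdeal F K n).comap f := by
    rw [augIdeal, Ideal.map_le_iff_le_comap]
    intro a ha
    simpa [augIdeal] using Ideal.mem_map_of_mem _ ha
  exact this hx

end

variable {p} {K : Type v} [CommRing K] [Nontrivial K]
  [Algebra (ZMod p) K] [PerfectRing K p]

theorem mem_augIdeal_of_pow_mem {n : ℕ} {x : BarTerm (ZMod p) K n}
    (hx : x ^ p ∈ augIdeal (ZMod p) K n) : x ∈ augIdeal (ZMod p) K n := by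
  rw [← frobeniusEquiv_symm_pow _ p x]
  refine Ideal.map_le_iff_le_comap.2 ?_ (Ideal.mem_map_of_mem (frobeniusEquiv _ p).symm hx)
  rw [augIdeal, Ideal.map_le_iff_le_comap, ← span_range_eq_ideal, Ideal.span_le]
  rintro _ ⟨a, rfl⟩
  obtain ⟨b, rfl⟩ := (PerfectRing.bijective_frobenius (R := K) (p := p)).2 a
  have : algebraMap _ (BarTerm (ZMod p) K n) ((1 : K) ⊗ₜ[ZMod p] (b ^ p) - (b ^ p) ⊗ₜ[ZMod p] 1) =
      (algebraMap _ _ (1 ⊗ₜ[ZMod p] b - b ⊗ₜ[ZMod p] 1)) ^ p := by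
    rw [map_sub, map_sub, sub_pow_char, ← map_pow, ← map_pow, Algebra.TensorProduct.tmul_pow,
      Algebra.TensorProduct.tmul_pow, one_pow]
  simp only [SetLike.mem_coe, Ideal.mem_comap, this, frobeniusEquiv_symm_pow]
  exact Ideal.mem_map_of_mem _ (Ideal.subset_span ⟨b, rfl⟩)

theorem exists_sub_d_mem {n : ℕ} {x : BarTerm (ZMod p) K (n + 1)}
    (hx : d (ZMod p) K n x ∈ augIdeal (ZMod p) K n) :
    ∃ w, x - d (ZMod p) K (n + 1) w ∈ augIdeal (ZMod p) K (n + 1) := by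
  have hp : p.Prime := Fact.out
  obtain ⟨z, w, hzw, hz, hz0⟩ := exists_higherFaces_eq_zero
    (bar (ZMod p) K) (ideal (ZMod p) K) x (by rw [bar_objD]; exact mem_augIdeal.1 hx)
  change BarTerm (ZMod p) K (n + 1) at z
  change BarTerm (ZMod p) K (n + 2) at w
  replace hz (i : Fin (n + 1)) : face (ZMod p) K i.succ z = 0 := hz i
  replace hz0 : face (ZMod p) K 0 z ∈ augIdeal (ZMod p) K n := mem_augIdeal.2 hz0
  replace hzw : x - z - d (ZMod p) K (n + 1) w ∈ augIdeal (ZMod p) K (n + 1) := by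
    rw [bar_objD] at hzw
    exact mem_augIdeal.2 hzw
  obtain ⟨y, rfl⟩ := (PerfectRing.bijective_frobenius (p := p)).2 z
  have hy (i : Fin (n + 1)) : face (ZMod p) K i.succ y = 0 :=
    (PerfectRing.bijective_frobenius (p := p)).1 <| by
      simpa [hp.ne_zero] using hz i
  have hy0 : face (ZMod p) K 0 y ∈ augIdeal (ZMod p) K n :=
    mem_augIdeal_of_pow_mem (by simpa using hz0)
  have hp1 : p - 1 ≠ 0 := by have := hp.two_le; lia
  let v := degen (ZMod p) K 0 y ^ (p - 1) * (degen (ZMod p) K 0 y - degen (ZMod p) K 1 y)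
  have hv0 : face (ZMod p) K 0 v =
      y ^ p - y ^ (p - 1) * degen (ZMod p) K 0 (face (ZMod p) K 0 y) := by
    have h₁ := face_degen_self 0 y
    have h₂ := face_degen_of_le (i := 0) (j := 0) le_rfl y
    simp only [Fin.castSucc_zero, Fin.succ_zero_eq_one] at h₁ h₂
    rw [map_mul, map_pow, map_sub, h₁, h₂, mul_sub, pow_sub_one_mul hp.ne_zero]
  have hv1 : face (ZMod p) K 1 v = 0 := by
    have h₁ := face_degen_succ 0 y
    have h₂ := face_degen_self 1 y
    simp only [Fin.castSucc_one, Fin.succ_zero_eq_one] at h₁ h₂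
    rw [map_mul, map_sub, h₁, h₂, sub_self, mul_zero]
  have hv (i : Fin (n + 1)) : face (ZMod p) K i.succ.succ v = 0 := by
    have h := face_degen_of_gt (i := i.succ) (j := 0) (by simp) y
    rw [hy, map_zero, Fin.castSucc_zero] at h
    rw [map_mul, map_pow, h, zero_pow hp1, zero_mul]
  have hdv : d (ZMod p) K (n + 1) v =
      y ^ p - y ^ (p - 1) * degen (ZMod p) K 0 (face (ZMod p) K 0 y) := by
    rw [d_apply, Fin.sum_univ_succ, Fin.sum_univ_succ]
    simp [hv0, hv1, hv]
  refine ⟨w + v, ?_⟩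
  have : x - d (ZMod p) K (n + 1) (w + v) = (x - y ^ p - d (ZMod p) K (n + 1) w) +
      y ^ (p - 1) * degen (ZMod p) K 0 (face (ZMod p) K 0 y) := by
    rw [map_add, hdv]; ring
  rw [this]
  exact add_mem hzw (Ideal.mul_mem_left _ _ (map_mem_augIdeal _ hy0))
end BarTerm
end

section

/-- The augmentation as a map of `k ⊗ k`-modules. -/
noncomputable def BarTerm.augLinear : BarTerm (ZMod p) k 0 →ₗ[EnvAlg p k] k :=
  { (BarTerm.aug : BarTerm (ZMod p) k 0 →ₐ[ZMod p] k) with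
    map_smul' := fun a x ↦ by
      change BarTerm.aug (a • x) = Algebra.TensorProduct.lmul' (ZMod p) a * BarTerm.aug x
      rw [Algebra.smul_def, map_mul, BarTerm.aug_algebraMap] }

theorem BarTerm.augLinear_surjective : Function.Surjective (BarTerm.augLinear p k) :=
  fun a ↦ ⟨AlgPower.single (ZMod p) k 0 a, AlgPower.lift_single _ _ _⟩

/-- The chain complex of the simplicial module `bar (ZMod p) k`. -/
noncomputable abbrev barComplex : ChainComplex (ModuleCat.{u} (EnvAlg p k)) ℕ :=
  (AlgebraicTopology.alternatingFaceMapComplex _).obj (bar (ZMod p) k)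

theorem barComplex_d (n : ℕ) :
    (barComplex p k).d (n + 1) n = ModuleCat.ofHom (BarTerm.d (ZMod p) k n) :=
  (AlgebraicTopology.alternatingFaceMapComplex_obj_d _ n).trans (BarTerm.bar_objD (ZMod p) k n)

/-- The augmentation of `barComplex p k`. -/
noncomputable def barComplexπ :
    barComplex p k ⟶ (ChainComplex.single₀ _).obj (ModuleCat.of (EnvAlg p k) k) :=
  (ChainComplex.toSingle₀Equiv _ _).symm ⟨ModuleCat.ofHom (BarTerm.augLinear p k), by
    rw [barComplex_d]
    exact ModuleCat.hom_ext (LinearMap.ext BarTerm.aug_d)⟩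

theorem barComplexπ_f_zero :
    (barComplexπ p k).f 0 = ModuleCat.ofHom (BarTerm.augLinear p k) := by
  simp [barComplexπ]
  rfl

theorem barComplex_exact_zero :
    (ShortComplex.mk ((barComplex p k).d 1 0) ((barComplexπ p k).f 0)
      (by rw [barComplex_d, barComplexπ_f_zero]
          exact ModuleCat.hom_ext (LinearMap.ext BarTerm.aug_d))).Exact := by
  simp_rw [barComplex_d, barComplexπ_f_zero]
  rw [ShortComplex.moduleCat_exact_iff]
  exact fun x hx ↦ BarTerm.exact_zero hx

instance : Epi ((barComplexπ p k).f 0) := by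
  rw [barComplexπ_f_zero]
  exact (ModuleCat.epi_iff_surjective _).2 (BarTerm.augLinear_surjective p k)

instance : QuasiIso (barComplexπ p k) where
  quasiIsoAt m := by
    induction m with
    | zero =>
      rw [ChainComplex.quasiIsoAt₀_iff, ShortComplex.quasiIso_iff_of_zeros' _ rfl rfl rfl]
      exact ⟨barComplex_exact_zero p k, inferInstanceAs (Epi ((barComplexπ p k).f 0))⟩
    | succ m _ =>
      rw [quasiIsoAt_iff_exactAt' (hL := ChainComplex.exactAt_succ_single_obj ..),
        HomologicalComplex.exactAt_iff' _ (m + 2) (m + 1) m (by simp) (by simp),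
        ShortComplex.moduleCat_exact_iff]
      intro x hx
      obtain ⟨y, hy⟩ := BarTerm.exact_succ (F := ZMod p) (K := k) (x := x)
        ((ConcreteCategory.congr_hom (barComplex_d p k m) x).symm.trans hx)
      exact ⟨y, (ConcreteCategory.congr_hom (barComplex_d p k (m + 1)) y).trans hy⟩

/-- The free resolution of `k` over `k ⊗ k` given by `barComplex p k`. -/
noncomputable def barResolution : ProjectiveResolution (ModuleCat.of (EnvAlg p k) k) where
  complex := barComplex p k
  projective n := ModuleCat.projective_of_free
    (Module.Free.chooseBasis (EnvAlg p k) (BarTerm (ZMod p) k n))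
  π := barComplexπ p k

end

/-- **Djament–Touzé, Lemma 6 (Hochschild cohomology of a perfect field).**
If `k` is a perfect field of characteristic `p > 0` and `A = k ⊗_{F_p} k`, with `k` an
`A`-module via `λ ⊗ μ ↦ λμ`, then `Ext^n_A(k, k) = 0` for all `n ≥ 1`. -/
theorem ext_enveloping_algebra_vanishes
    [CharP k p] [PerfectField k] [HasExt.{w} (ModuleCat.{u} (EnvAlg p k))]
    (n : ℕ) (hn : 1 ≤ n)
    (x : Ext (ModuleCat.of (EnvAlg p k) k) (ModuleCat.of (EnvAlg p k) k) n) :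
    x = 0 := by
  obtain ⟨m, rfl⟩ := Nat.exists_eq_add_of_le' hn
  have : PerfectRing k p := PerfectField.toPerfectRing p
  obtain ⟨f, hf, rfl⟩ := (barResolution p k).extMk_surjective x (m + 2) rfl
  rw [(barResolution p k).extMk_eq_zero_iff f _ rfl hf m rfl]
  have hfd (w : BarTerm (ZMod p) k (m + 2)) : f.hom (BarTerm.d (ZMod p) k (m + 1) w) = 0 :=
    (congr_arg f.hom (ConcreteCategory.congr_hom (barComplex_d p k (m + 1)) w)).symm.trans
      (ConcreteCategory.congr_hom hf w)
  let f' : BarTerm (ZMod p) k (m + 1) →ₗ[EnvAlg p k] k := f.hom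
  obtain ⟨g, hg⟩ := exists_comp_eq_of_ker_smul_top (Algebra.TensorProduct.lmul'' (ZMod p))
    (fun _ _ ↦ rfl) (BarTerm.d (ZMod p) k m) f' fun x hx ↦ by
      obtain ⟨w, hw⟩ := BarTerm.exists_sub_d_mem (BarTerm.mem_augIdeal.2 hx)
      have h : f' (x - BarTerm.d (ZMod p) k (m + 1) w) = 0 := by
        refine Submodule.smul_induction_on (BarTerm.mem_augIdeal.1 hw) (fun a ha y _ ↦ ?_)
          fun y z hy hz ↦ by rw [map_add, hy, hz, add_zero]
        rw [map_smul]
        change Algebra.TensorProduct.lmul' (ZMod p) a * f' y = 0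
        rw [show Algebra.TensorProduct.lmul' (ZMod p) a = 0 from ha, zero_mul]
      rwa [map_sub, show f' (BarTerm.d (ZMod p) k (m + 1) w) = 0 from hfd w, sub_zero] at h
  refine ⟨ModuleCat.ofHom g, ?_⟩
  change (barComplex p k).d (m + 1) m ≫ _ = f
  rw [barComplex_d]
  exact ModuleCat.hom_ext hg

end

end DjamentTouze
end

section
/- Let C be a preadditive category, let (x_i)_{i∈I} be a family of objects of C admitting a coproduct c with coprojections ι_i : x_i → c, and suppose that the canonical group homomorphism ⊕_{i∈I} Hom_C(c, x_i) → Hom_C(c, c), sending a finitely supported family (f_i) to Σ_i ι_i ∘ f_i, is surjective. Then for all but finitely many indices i ∈ I, the identity morphism of x_i is zero (i.e. x_i is a zero object); consequently c is isomorphic to the coproduct of a finite subfamily of the x_i. -/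
/-! STATEMENT 8: in a preadditive category, if `c` is a coproduct of a family `(x i)` and the
canonical map `⊕ᵢ Hom(c, xᵢ) → Hom(c, c)`, `(fᵢ) ↦ Σ ιᵢ ∘ fᵢ`, is surjective, then all but
finitely many `x i` are zero objects, and `c` is the coproduct of a finite subfamily. -/

universe w v u

open CategoryTheory Limits

namespace DjamentTouze

/-- Let `C` be a preadditive category, `(x i)` a family of objects admitting a coproduct `c`
with coprojections `ι i : x i ⟶ c`.  If every endomorphism `g : c ⟶ c` can be written as a
finite sum `Σ_{i ∈ s} f i ≫ ι i` with `f i : c ⟶ x i` (i.e. the canonical homomorphism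
`⊕ᵢ Hom(c, xᵢ) → Hom(c, c)` on finitely supported families is surjective), then `𝟙 (x i) = 0`
(i.e. `x i` is a zero object) for all but finitely many `i`; consequently `c`, with the
restricted coprojections, is the coproduct of a finite subfamily of the `x i`. -/
theorem finite_support_of_coproduct_hom_surjective
    {C : Type u} [Category.{v} C] [Preadditive C] {I : Type w}
    (x : I → C) (c : C) (ι : ∀ i, x i ⟶ c) (hc : IsColimit (Cofan.mk c ι))
    (hsurj : ∀ g : c ⟶ c, ∃ (s : Finset I) (f : ∀ i, c ⟶ x i),
      g = ∑ i ∈ s, f i ≫ ι i) :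
    {i : I | 𝟙 (x i) ≠ 0}.Finite ∧
      ∃ s : Finset I,
        Nonempty (IsColimit (Cofan.mk (f := fun i : s => x i) c (fun i : s => ι i))) := by
  classical
  obtain ⟨s, f, hf⟩ := hsurj (𝟙 c)
  have h0 : ∀ j, j ∉ s → 𝟙 (x j) = 0 := by
    intro j hj
    let φ : ∀ i, x i ⟶ x j := fun i => if h : i = j then eqToHom (by rw [h]) else 0
    let π : c ⟶ x j := Cofan.IsColimit.desc hc φ
    have hπ : ∀ i, ι i ≫ π = φ i := fun i => Cofan.IsColimit.fac hc φ i
    have hπ0 : π = 0 := by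
      rw [← Category.id_comp π, hf, Preadditive.sum_comp]
      refine Finset.sum_eq_zero fun i hi => ?_
      have hij : i ≠ j := fun h => hj (h ▸ hi)
      rw [Category.assoc, hπ]
      simp [φ, hij]
    have hj' := hπ j
    rw [hπ0] at hj'
    simpa [φ] using hj'.symm
  refine ⟨s.finite_toSet.subset fun i hi => by_contra fun h => hi (h0 i h), s, ⟨?_⟩⟩
  let ψ : ∀ t : Cofan (fun i : s => x i), ∀ i, x i ⟶ t.pt :=
    fun t i => if h : i ∈ s then t.inj ⟨i, h⟩ else 0
  have hψ : ∀ t i, ι i ≫ Cofan.IsColimit.desc hc (ψ t) = ψ t i :=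
    fun t i => Cofan.IsColimit.fac hc (ψ t) i
  refine Cofan.IsColimit.mk _ (fun t => Cofan.IsColimit.desc hc (ψ t)) ?_ ?_
  · intro t i
    exact (hψ t i).trans (by simp [ψ])
  · intro t m hm
    refine Cofan.IsColimit.hom_ext hc _ _ fun i => ?_
    refine Eq.trans ?_ (hψ t i).symm
    change ι i ≫ m = ψ t i
    by_cases hi : i ∈ s
    · exact (hm ⟨i, hi⟩).trans (by simp [ψ, hi])
    · rw [← Category.id_comp (ι i), h0 i hi]
      simp [ψ, hi]

end DjamentTouze
end
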